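/- arXiv:1209.3759 — 2 statements merged into one kernel-verified Lean document; each statement's English description precedes it below -/
import Mathlib

section
/- Let K_n (n ≥ 3) be the complete graph and let w : 2^E → ℝ≥0 be a monotone, normalized (w(∅) = 0) submodular function with curvature κ ∈ [0,1] on its edge set E. If T is the final set of any greedy sequence for the undirected TSP independence system with objective w, then w(T) ≥ w(T*) / (2 + κ), where T* is the edge set of a maximum-reward Hamiltonian cycle (tour). -/
/-- Degree of a vertex in an edge set. -/
def degIn {V : Type*} [DecidableEq V] (S : Finset (Sym2 V)) (v : V) : ℕ :=
  (S.filter (fun e => v ∈ e)).card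

/-- `S` is the edge set of a Hamiltonian cycle of the complete graph on `V`. -/
def IsTour {V : Type*} [DecidableEq V] (S : Finset (Sym2 V)) : Prop :=
  ∃ (v : V) (w : (SimpleGraph.fromEdgeSet (S : Set (Sym2 V))).Walk v v),
    w.IsHamiltonianCycle ∧ S = w.edges.toFinset

/-- The undirected TSP independence system on the complete graph `K_n`. -/
def TSPIndep {V : Type*} [DecidableEq V] (S : Finset (Sym2 V)) : Prop :=
  (∀ e ∈ S, ¬ e.IsDiag) ∧ (∀ v : V, degIn S v ≤ 2) ∧
  ((SimpleGraph.fromEdgeSet (S : Set (Sym2 V))).IsAcyclic ∨ IsTour S)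

def Submodular {α : Type*} [DecidableEq α] (f : Finset α → ℝ) : Prop :=
  ∀ S T : Finset α, f (S ∪ T) + f (S ∩ T) ≤ f S + f T

def MonotoneFn {α : Type*} (f : Finset α → ℝ) : Prop :=
  ∀ S T : Finset α, S ⊆ T → f S ≤ f T

def HasCurvature {α : Type*} [DecidableEq α] (f : Finset α → ℝ) (κ : ℝ) : Prop :=
  ∀ (A : Finset α) (e : α), e ∉ A → (1 - κ) * f {e} ≤ f (insert e A) - f A

structure IsGreedySeq {α : Type*} [DecidableEq α] (ℱ : Set (Finset α)) (f : Finset α → ℝ)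
    (l : List α) : Prop where
  nodup : l.Nodup
  indep : ∀ t : ℕ, (l.take t).toFinset ∈ ℱ
  greedy : ∀ (t : ℕ) (ht : t < l.length), ∀ e ∉ (l.take t).toFinset,
    insert e (l.take t).toFinset ∈ ℱ →
    f (insert e (l.take t).toFinset) - f (l.take t).toFinset ≤
      f (insert (l.get ⟨t, ht⟩) (l.take t).toFinset) - f (l.take t).toFinset
  maximal : ∀ e ∉ l.toFinset, insert e l.toFinset ∉ ℱ

section Greedy

open Finset

variable {α : Type*} [DecidableEq α] {f : Finset α → ℝ} {κ : ℝ}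

theorem Submodular.marginal_le (hsub : Submodular f) (hmono : MonotoneFn f) {S T : Finset α}
    (hST : S ⊆ T) (e : α) : f (insert e T) - f T ≤ f (insert e S) - f S := by
  have h := hsub (insert e S) T
  have h1 : insert e S ∪ T = insert e T := by rw [insert_union, union_eq_right.mpr hST]
  have h2 : f S ≤ f (insert e S ∩ T) := hmono _ _ (subset_inter (subset_insert e S) hST)
  rw [h1] at h
  linarith

theorem Submodular.le_add_sum_marginal (hsub : Submodular f) (hmono : MonotoneFn f)
    (S X : Finset α) : f (X ∪ S) ≤ f S + ∑ e ∈ X, (f (insert e S) - f S) := by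
  induction X using Finset.induction_on with
  | empty => simp
  | insert a X ha ih =>
    have := hsub.marginal_le hmono (subset_union_right : S ⊆ X ∪ S) a
    rw [sum_insert ha, insert_union]
    linarith

theorem List.toFinset_take_succ {l : List α} {t : ℕ} (ht : t < l.length) :
    (l.take (t + 1)).toFinset = insert l[t] (l.take t).toFinset := by
  ext x
  simp only [List.take_add_one, List.getElem?_eq_getElem ht, Option.toList_some,
    List.mem_toFinset, List.mem_append, List.mem_singleton, Finset.mem_insert]
  tauto

theorem List.toFinset_take_mono (l : List α) : Monotone fun t => (l.take t).toFinset :=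
  fun _ _ hst _ hx =>
    List.mem_toFinset.mpr (List.take_subset_take_left l hst (List.mem_toFinset.mp hx))

theorem List.Nodup.getElem_notMem_toFinset_take {l : List α} (hl : l.Nodup) {t : ℕ}
    (ht : t < l.length) : l[t] ∉ (l.take t).toFinset := by
  rw [List.mem_toFinset, List.mem_take_iff_idxOf_lt (List.getElem_mem ht), hl.idxOf_getElem]
  exact lt_irrefl t

theorem List.Nodup.card_toFinset_take {l : List α} (hl : l.Nodup) {t : ℕ} (ht : t ≤ l.length) :
    #(l.take t).toFinset = t := by
  rw [List.toFinset_card_of_nodup (hl.sublist (List.take_sublist t l)), List.length_take,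
    min_eq_left ht]

/-- The gain of `e` when it is added to the elements of `l` listed before it, or to all of `l`
if `e` does not occur in `l`. -/
def seqGain (f : Finset α → ℝ) (l : List α) (e : α) : ℝ :=
  f (insert e (l.take (l.idxOf e)).toFinset) - f (l.take (l.idxOf e)).toFinset

theorem seqGain_nonneg (hmono : MonotoneFn f) (l : List α) (e : α) : 0 ≤ seqGain f l e :=
  sub_nonneg.mpr (hmono _ _ (subset_insert _ _))

theorem HasCurvature.le_union_take (hcurv : HasCurvature f κ) (hκ1 : κ ≤ 1)
    (hsub : Submodular f) (hmono : MonotoneFn f) (hnorm : f ∅ = 0) {l : List α} (hl : l.Nodup)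
    (O : Finset α) {t : ℕ} (ht : t ≤ l.length) :
    f O + (1 - κ) * (f (l.take t).toFinset - ∑ e ∈ O ∩ (l.take t).toFinset, seqGain f l e) ≤
      f (O ∪ (l.take t).toFinset) := by
  induction t with
  | zero => simp [hnorm]
  | succ t ih =>
    have ih := ih (Nat.le_of_succ_le ht)
    have hg := hl.getElem_notMem_toFinset_take ht
    have hidx := hl.idxOf_getElem t ht
    rw [List.toFinset_take_succ ht]
    set g := l[t]
    set S := (l.take t).toFinset
    by_cases hgO : g ∈ O
    · have hgain : seqGain f l g = f (insert g S) - f S := by rw [seqGain, hidx]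
      rw [inter_insert_of_mem hgO, sum_insert (fun h => hg (mem_inter.mp h).2), hgain,
        union_insert, insert_eq_of_mem (mem_union_left S hgO)]
      linarith
    · rw [inter_insert_of_notMem hgO, union_insert]
      have h1 := hcurv (O ∪ S) g (by simp [hgO, hg])
      have h2 := hsub.marginal_le hmono (empty_subset S) g
      rw [hnorm, insert_empty_eq, sub_zero] at h2
      have h3 := mul_le_mul_of_nonneg_left h2 (sub_nonneg.mpr hκ1)
      linarith

theorem HasCurvature.le_add_sum_seqGain (hcurv : HasCurvature f κ) (hκ0 : 0 ≤ κ) (hκ1 : κ ≤ 1)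
    (hsub : Submodular f) (hmono : MonotoneFn f) (hnorm : f ∅ = 0) {l : List α} (hl : l.Nodup)
    (O : Finset α) : f O ≤ κ * f l.toFinset + ∑ e ∈ O, seqGain f l e := by
  have h1 := hcurv.le_union_take hκ1 hsub hmono hnorm hl O le_rfl
  have h2 := hsub.le_add_sum_marginal hmono l.toFinset (O \ l.toFinset)
  rw [List.take_length] at h1
  rw [sdiff_union_self_eq_union] at h2
  have h3 : ∑ e ∈ O \ l.toFinset, (f (insert e l.toFinset) - f l.toFinset) =
      ∑ e ∈ O \ l.toFinset, seqGain f l e := sum_congr rfl fun e he => by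
    rw [seqGain, List.idxOf_of_notMem (by simpa using (mem_sdiff.mp he).2), List.take_length]
  have h4 := sum_inter_add_sum_sdiff O l.toFinset (seqGain f l)
  have h5 : 0 ≤ κ * ∑ e ∈ O ∩ l.toFinset, seqGain f l e :=
    mul_nonneg hκ0 (sum_nonneg fun e _ => seqGain_nonneg hmono l e)
  linarith

variable {ℱ : Set (Finset α)} {l : List α}

theorem IsGreedySeq.seqGain_le (hl : IsGreedySeq ℱ f l) (hsub : Submodular f)
    (hmono : MonotoneFn f) {e : α} {t : ℕ} (ht : t < l.length)
    (he : e ∉ (l.take t).toFinset) (hins : insert e (l.take t).toFinset ∈ ℱ) :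
    seqGain f l e ≤ f (l.take (t + 1)).toFinset - f (l.take t).toFinset := by
  have hidx : t ≤ l.idxOf e := by
    by_cases hel : e ∈ l
    · rw [List.mem_toFinset, List.mem_take_iff_idxOf_lt hel] at he
      exact not_lt.mp he
    · rw [List.idxOf_of_notMem hel]
      exact ht.le
  rw [List.toFinset_take_succ ht]
  exact (hsub.marginal_le hmono (List.toFinset_take_mono l hidx) e).trans
    (hl.greedy t ht e he hins)

/-- Suppose each independent `S` blocks at most `p * #S` elements of `O`, and every element of
`O` that is not blocked can be added to `S`. Then the gains of the elements of `O` sum to at most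
`p` times the value of the greedy solution. -/
theorem IsGreedySeq.sum_seqGain_le (hl : IsGreedySeq ℱ f l) (hsub : Submodular f)
    (hmono : MonotoneFn f) (hnorm : f ∅ = 0) {p : ℕ} {O : Finset α}
    {B : Finset α → Finset α}
    (hB : ∀ S ∈ ℱ, ∀ e ∈ O, e ∉ B S → e ∉ S ∧ insert e S ∈ ℱ)
    (hcard : ∀ S ∈ ℱ, #(B S) ≤ p * #S) :
    ∑ e ∈ O, seqGain f l e ≤ p * f l.toFinset := by
  classical
  let S : ℕ → Finset α := fun t => (l.take t).toFinset
  have hSlen : S l.length = l.toFinset := by simp [S]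
  let slots : O → Finset (ℕ × Fin p) := fun e =>
    ((range l.length).filter fun t => e.1 ∉ B (S t)) ×ˢ univ
  have hend : ∀ e ∈ O, e ∈ B (S l.length) := fun e he => by
    by_contra hcon
    obtain ⟨h1, h2⟩ := hB _ (hl.indep _) e he hcon
    exact hl.maximal e (hSlen ▸ h1) (hSlen ▸ h2)
  obtain ⟨φ, hφinj, hφ⟩ := (all_card_le_biUnion_card_iff_exists_injective slots).mp fun X => by
    have hex : ∃ m, ∀ e ∈ X, e.1 ∈ B (S m) := ⟨l.length, fun e _ => hend e e.2⟩
    have hm_le : Nat.find hex ≤ l.length := Nat.find_min' hex fun e _ => hend e e.2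
    have hsubset : range (Nat.find hex) ×ˢ (univ : Finset (Fin p)) ⊆ X.biUnion slots := by
      rintro ⟨t, j⟩ h
      have ht : t < Nat.find hex := by simpa using h
      have hnot := Nat.find_min hex ht
      push Not at hnot
      obtain ⟨e, heX, he⟩ := hnot
      simp only [slots, mem_biUnion, mem_product, mem_filter, mem_range, mem_univ, and_true]
      exact ⟨e, heX, ht.trans_le hm_le, he⟩
    calc #X = #(X.map (Function.Embedding.subtype _)) := (card_map _).symm
      _ ≤ #(B (S (Nat.find hex))) := card_le_card fun e he => by
          obtain ⟨e', he', rfl⟩ := mem_map.mp he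
          exact Nat.find_spec hex e' he'
      _ ≤ p * #(S (Nat.find hex)) := hcard _ (hl.indep _)
      _ = #(range (Nat.find hex) ×ˢ (univ : Finset (Fin p))) := by
          rw [show #(S (Nat.find hex)) = _ from hl.nodup.card_toFinset_take hm_le, card_product,
            card_range, card_fin, mul_comm]
      _ ≤ _ := card_le_card hsubset
  have hφ' : ∀ e, (φ e).1 < l.length ∧ e.1 ∉ B (S (φ e).1) := fun e => by
    simpa [slots] using hφ e
  have hgain_nonneg : ∀ t, 0 ≤ f (S (t + 1)) - f (S t) := fun t =>
    sub_nonneg.mpr (hmono _ _ (List.toFinset_take_mono l t.le_succ))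
  calc ∑ e ∈ O, seqGain f l e = ∑ e : O, seqGain f l e.1 := (sum_coe_sort O _).symm
    _ ≤ ∑ e : O, (f (S ((φ e).1 + 1)) - f (S (φ e).1)) := sum_le_sum fun e _ => by
        obtain ⟨h1, h2⟩ := hB _ (hl.indep _) e.1 e.2 (hφ' e).2
        exact hl.seqGain_le hsub hmono (hφ' e).1 h1 h2
    _ = ∑ x ∈ univ.image φ, (f (S (x.1 + 1)) - f (S x.1)) :=
        (sum_image (f := fun x : ℕ × Fin p => f (S (x.1 + 1)) - f (S x.1))
          fun _ _ _ _ h => hφinj h).symm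
    _ ≤ ∑ x ∈ range l.length ×ˢ (univ : Finset (Fin p)), (f (S (x.1 + 1)) - f (S x.1)) := by
        refine sum_le_sum_of_subset_of_nonneg (fun x hx => ?_) fun x _ _ => hgain_nonneg x.1
        obtain ⟨e, -, rfl⟩ := mem_image.mp hx
        simpa using (hφ' e).1
    _ = p * f l.toFinset := by
        rw [sum_product_right]
        simp only [sum_range_sub fun t => f (S t), sum_const, card_univ, Fintype.card_fin,
          nsmul_eq_mul, hSlen]
        simp [S, hnorm]

end Greedy

section Tour

open Finset SimpleGraph

variable {V : Type*} [DecidableEq V] {S T : Finset (Sym2 V)}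

theorem one_le_degIn {e : Sym2 V} {v : V} (he : e ∈ S) (hv : v ∈ e) : 1 ≤ degIn S v :=
  card_pos.mpr ⟨e, mem_filter.mpr ⟨he, hv⟩⟩

theorem degIn_insert_le (e : Sym2 V) (S : Finset (Sym2 V)) (v : V) :
    degIn (insert e S) v ≤ degIn S v + 1 := by
  unfold degIn
  rw [filter_insert]
  split_ifs
  · exact card_insert_le _ _
  · exact Nat.le_succ _

theorem IsTour.not_isDiag (hT : IsTour T) {e : Sym2 V} (he : e ∈ T) : ¬ e.IsDiag := by
  obtain ⟨v, w, -, hTw⟩ := hT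
  rw [hTw, List.mem_toFinset] at he
  exact not_isDiag_of_mem_edgeSet _ (w.edges_subset_edgeSet he)

theorem IsTour.one_le_degIn (hT : IsTour T) (v : V) : 1 ≤ degIn T v := by
  obtain ⟨a, w, hw, hTw⟩ := hT
  obtain ⟨e, he, hv⟩ :=
    (Walk.mem_support_iff_exists_mem_edges_of_not_nil hw.not_nil).mp (hw.mem_support v)
  exact _root_.one_le_degIn (hTw ▸ List.mem_toFinset.mpr he) hv

theorem IsTour.degIn_le_two (hT : IsTour T) (v : V) : degIn T v ≤ 2 := by
  obtain ⟨a, w, hw, hTw⟩ := hT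
  have hn := hw.isCycle.ncard_neighborSet_toSubgraph_eq_two (hw.mem_support v)
  have hfin : (w.toSubgraph.neighborSet v).Finite := Set.finite_of_ncard_pos (by omega)
  rw [Set.ncard_eq_toFinset_card _ hfin] at hn
  rw [← hn]
  refine (card_le_card fun e he => ?_).trans (card_image_le (f := fun u => s(v, u)))
  obtain ⟨heT, u, rfl⟩ := mem_filter.mp he
  refine mem_image_of_mem _ (hfin.mem_toFinset.mpr ?_)
  rw [hTw, List.mem_toFinset] at heT
  exact w.mem_edges_toSubgraph.mpr heT

theorem sum_degIn_le [Fintype V] (S : Finset (Sym2 V)) : ∑ v, degIn S v ≤ 2 * #S := by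
  calc ∑ v, degIn S v = ∑ e ∈ S, #{v | v ∈ e} :=
        sum_card_bipartiteAbove_eq_sum_card_bipartiteBelow (fun v e => v ∈ e)
    _ = ∑ e ∈ S, #e.toFinset := by
        refine sum_congr rfl fun e _ => congrArg card ?_
        ext v
        simp
    _ ≤ ∑ e ∈ S, 2 := sum_le_sum fun e _ => by
        rw [Sym2.card_toFinset]
        split_ifs <;> omega
    _ = 2 * #S := by rw [sum_const, smul_eq_mul, mul_comm]

/-- The edges of `T` whose two endpoints have total degree at least `2` in `S`. -/
def heavyEdges (T S : Finset (Sym2 V)) : Finset (Sym2 V) :=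
  T.filter fun e => 2 ≤ ∑ v ∈ e.toFinset, degIn S v

theorem card_heavyEdges_le [Fintype V] (hT : ∀ v, degIn T v ≤ 2) (S : Finset (Sym2 V)) :
    #(heavyEdges T S) ≤ 2 * #S := by
  have h : 2 * #(heavyEdges T S) ≤ 2 * (2 * #S) := by
    calc 2 * #(heavyEdges T S) = ∑ e ∈ heavyEdges T S, 2 := by
          rw [sum_const, smul_eq_mul, mul_comm]
      _ ≤ ∑ e ∈ heavyEdges T S, ∑ v ∈ e.toFinset, degIn S v :=
          sum_le_sum fun e he => (mem_filter.mp he).2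
      _ ≤ ∑ e ∈ T, ∑ v ∈ e.toFinset, degIn S v :=
          sum_le_sum_of_subset (filter_subset _ _)
      _ = ∑ v, ∑ e ∈ T with v ∈ e, degIn S v := sum_comm' fun e v => by simp
      _ = ∑ v, degIn T v * degIn S v := sum_congr rfl fun v _ => by
          rw [sum_const, smul_eq_mul]
          rfl
      _ ≤ ∑ v, 2 * degIn S v := sum_le_sum fun v _ => Nat.mul_le_mul_right _ (hT v)
      _ = 2 * ∑ v, degIn S v := (mul_sum _ _ _).symm
      _ ≤ 2 * (2 * #S) := Nat.mul_le_mul_left 2 (sum_degIn_le S)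
  omega

theorem not_reachable_of_degIn_eq_zero {u v : V} (huv : u ≠ v) (hu : degIn S u = 0) :
    ¬ (fromEdgeSet (S : Set (Sym2 V))).Reachable u v := by
  rintro ⟨p⟩
  cases p with
  | nil => exact huv rfl
  | cons h _ =>
    have := one_le_degIn (mem_coe.mp ((fromEdgeSet_adj _).mp h).1) (Sym2.mem_mk_left u _)
    omega

theorem TSPIndep.insert_of_sum_degIn_lt (hS : TSPIndep S) {e : Sym2 V} (he : ¬ e.IsDiag)
    (hdeg : ∑ v ∈ e.toFinset, degIn S v < 2) : e ∉ S ∧ TSPIndep (insert e S) := by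
  induction e using Sym2.ind with
  | _ u v =>
  have huv : u ≠ v := he
  rw [Sym2.toFinset_mk_eq, sum_pair huv] at hdeg
  refine ⟨fun h => ?_, ?_, fun x => ?_, Or.inl ?_⟩
  · have h1 := one_le_degIn h (Sym2.mem_mk_left u v)
    have h2 := one_le_degIn h (Sym2.mem_mk_right u v)
    omega
  · exact forall_mem_insert _ _ _ |>.mpr ⟨he, hS.1⟩
  · by_cases hx : x ∈ s(u, v)
    · have := degIn_insert_le s(u, v) S x
      rcases Sym2.mem_iff.mp hx with rfl | rfl <;> omega
    · have : degIn (insert s(u, v) S) x = degIn S x := by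
        unfold degIn
        rw [filter_insert, if_neg hx]
      exact this ▸ hS.2.1 x
  · have hacyc : (fromEdgeSet (S : Set (Sym2 V))).IsAcyclic := hS.2.2.resolve_right fun h => by
      have h1 := h.one_le_degIn u
      have h2 := h.one_le_degIn v
      omega
    have hins : fromEdgeSet ((insert s(u, v) S : Finset (Sym2 V)) : Set (Sym2 V)) =
        fromEdgeSet (S : Set (Sym2 V)) ⊔ edge u v := by
      rw [coe_insert, Set.insert_eq, Set.union_comm, edge, fromEdgeSet_union]
    rw [hins]
    refine hacyc.sup_edge_of_not_reachable ?_
    by_cases hu : degIn S u = 0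
    · exact not_reachable_of_degIn_eq_zero huv hu
    · exact fun h => not_reachable_of_degIn_eq_zero huv.symm (by omega) h.symm

end Tour

/-- The greedy tour algorithm is a `1/(2+κ)`-approximation to the maximum-reward tour. -/
theorem greedy_tour_approx {V : Type*} [Fintype V] [DecidableEq V]
    (hn : 3 ≤ Fintype.card V)
    (w : Finset (Sym2 V) → ℝ) (κ : ℝ) (l : List (Sym2 V)) (Tstar : Finset (Sym2 V))
    (hnonneg : ∀ S : Finset (Sym2 V), 0 ≤ w S)
    (hsub : Submodular w) (hmono : MonotoneFn w) (hnorm : w ∅ = 0)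
    (hκ0 : 0 ≤ κ) (hκ1 : κ ≤ 1) (hcurv : HasCurvature w κ)
    (hgreedy : IsGreedySeq {S | TSPIndep S} w l)
    (hTstar : IsTour Tstar) (hTmax : ∀ T' : Finset (Sym2 V), IsTour T' → w T' ≤ w Tstar) :
    w Tstar / (2 + κ) ≤ w l.toFinset := by
  have hgain := hgreedy.sum_seqGain_le hsub hmono hnorm (p := 2) (O := Tstar)
    (fun S hS e he hheavy => TSPIndep.insert_of_sum_degIn_lt hS (hTstar.not_isDiag he)
      (not_le.mp fun h => hheavy (Finset.mem_filter.mpr ⟨he, h⟩)))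
    (fun S _ => card_heavyEdges_le hTstar.degIn_le_two S)
  have hopt := hcurv.le_add_sum_seqGain hκ0 hκ1 hsub hmono hnorm hgreedy.nodup Tstar
  rw [div_le_iff₀ (by linarith)]
  push_cast at hgain
  linarith
end

section
/- Let S be a finite set, let f : 2^S → ℝ≥0 be a monotone nonnegative submodular function, and let B₁, …, B_k (k ≥ 1) be pairwise disjoint subsets of S. Then there exists an index i ∈ {1, …, k} such that f(S \ B_i) ≥ (1 − 1/k) · f(S). -/
/-- The total loss from removing pairwise disjoint sets one at a time is at most the loss from
removing their union. -/
theorem Submodular.sum_sub_sdiff_le {α ι : Type*} [DecidableEq α]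
    {f : Finset α → ℝ} (hf : Submodular f) (S : Finset α) (B : ι → Finset α)
    (hB : ∀ i j, i ≠ j → Disjoint (B i) (B j)) (t : Finset ι) :
    ∑ i ∈ t, (f S - f (S \ B i)) ≤ f S - f (S \ t.biUnion B) := by
  classical
  induction t using Finset.induction_on with
  | empty => simp
  | insert i t hi ih =>
    have hd : Disjoint (B i) (t.biUnion B) :=
      (Finset.disjoint_biUnion_right _ _ _).2 fun j hj => hB i j (ne_of_mem_of_not_mem hj hi).symm
    have h := hf (S \ B i) (S \ t.biUnion B)
    have hunion : S \ B i ∪ S \ t.biUnion B = S := by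
      rw [← Finset.sdiff_inter_distrib_right, Finset.disjoint_iff_inter_eq_empty.1 hd,
        Finset.sdiff_empty]
    rw [hunion, ← Finset.sdiff_union_distrib] at h
    rw [Finset.sum_insert hi, Finset.biUnion_insert]
    linarith

/-- For pairwise disjoint subsets `B₁, …, B_k` of `S`, some `B_i` can be removed
while keeping at least a `(1 − 1/k)` fraction of the value. -/
theorem exists_removal_keeping_fraction {α : Type*} [DecidableEq α]
    (S : Finset α) (f : Finset α → ℝ) (k : ℕ) (hk : 1 ≤ k) (B : Fin k → Finset α)
    (hsub : Submodular f) (hmono : MonotoneFn f)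
    (hnonneg : ∀ A : Finset α, 0 ≤ f A)
    (hBsub : ∀ i, B i ⊆ S)
    (hdisj : ∀ i j, i ≠ j → Disjoint (B i) (B j)) :
    ∃ i : Fin k, (1 - 1 / (k : ℝ)) * f S ≤ f (S \ B i) := by
  have hk0 : (0 : ℝ) < k := by exact_mod_cast hk
  have : Nonempty (Fin k) := ⟨⟨0, hk⟩⟩
  have hsum : ∑ i : Fin k, (f S - f (S \ B i)) ≤ ∑ _i : Fin k, f S / k := by
    calc ∑ i : Fin k, (f S - f (S \ B i))
        ≤ f S - f (S \ Finset.univ.biUnion B) := hsub.sum_sub_sdiff_le S B hdisj Finset.univ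
      _ ≤ f S := sub_le_self _ (hnonneg _)
      _ = ∑ _i : Fin k, f S / k := by
        simp only [Finset.sum_const, Finset.card_univ, Fintype.card_fin, nsmul_eq_mul]
        field_simp
  obtain ⟨i, -, hi⟩ := Finset.exists_le_of_sum_le Finset.univ_nonempty hsum
  refine ⟨i, ?_⟩
  have : (1 - 1 / (k : ℝ)) * f S = f S - f S / k := by ring
  linarith
end
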